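/- Let d ≤ m and let Ξ be an integer d×m matrix whose first d columns are linearly independent. Then the lattice shifts of the centered box spline M_Ξ are linearly independent — i.e., whenever c : ℤ^d → ℝ satisfies ∑_{j ∈ ℤ^d} c(j) M_Ξ(x − j) = 0 for every x ∈ ℝ^d (the sum has only finitely many nonzero terms for each x), then c(j) = 0 for all j — if and only if every invertible d×d submatrix of Ξ formed by selecting d of its columns has determinant ±1. -/

import Mathlib

open MeasureTheory

/-- The centered box spline for a `d × (d+n)` direction matrix, by recursion on `n`:
for `n = 0` it is the normalized indicator of the half-open parallelepiped
`Ξ [-1/2,1/2)^d`; for `n+1` it is the average of the translates of the box spline of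
`Ξ` with its last column removed, in the direction of that last column. -/
noncomputable def boxSplineAux (d : ℕ) : (n : ℕ) → Matrix (Fin d) (Fin (d + n)) ℝ → ((Fin d → ℝ) → ℝ)
  | 0, Ξ => fun x =>
      Set.indicator
        {y : Fin d → ℝ | ∃ t : Fin d → ℝ, (∀ i, t i ∈ Set.Ico (-(1:ℝ)/2) (1/2)) ∧
          y = Matrix.mulVec (Matrix.of fun (i j : Fin d) => Ξ i (Fin.cast (Nat.add_zero d).symm j)) t}
        (fun _ => |Matrix.det (Matrix.of fun (i j : Fin d) => Ξ i (Fin.cast (Nat.add_zero d).symm j))|⁻¹) x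
  | (n+1), Ξ => fun x =>
      ∫ t in (-(1:ℝ)/2)..(1/2),
        boxSplineAux d n (fun i j => Ξ i (Fin.castSucc j)) (x - t • fun i => Ξ i (Fin.last (d + n)))

/-- The centered box spline `M_Ξ` of a `d × m` direction matrix `Ξ`, `d ≤ m`. -/
noncomputable def boxSpline {d m : ℕ} (hdm : d ≤ m) (Ξ : Matrix (Fin d) (Fin m) ℝ) :
    (Fin d → ℝ) → ℝ :=
  boxSplineAux d (m - d) (fun i j => Ξ i (Fin.cast (Nat.add_sub_cancel' hdm) j))

/-- The inclusion of the lattice `ℤ^d` into `ℝ^d`. -/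
def intCastVec (d : ℕ) : (Fin d → ℤ) →+ (Fin d → ℝ) :=
  (Int.castAddHom ℝ).compLeft (Fin d)

theorem finite_setOf_norm_intCastVec_le (d : ℕ) (R : ℝ) :
    {j : Fin d → ℤ | ‖intCastVec d j‖ ≤ R}.Finite := by
  refine (Set.finite_Icc (fun _ : Fin d => -⌈R⌉) (fun _ => ⌈R⌉)).subset fun j hj => ?_
  have h : ∀ i, |(j i : ℝ)| ≤ ⌈R⌉ := fun i =>
    ((norm_le_pi_norm (intCastVec d j) i).trans hj).trans (Int.le_ceil R)
  refine ⟨fun i => ?_, fun i => ?_⟩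
  · exact_mod_cast (abs_le.mp (h i)).1
  · exact_mod_cast (abs_le.mp (h i)).2

theorem HasCompactSupport.exists_norm_le_of_ne_zero {E : Type*} [NormedAddCommGroup E]
    {φ : E → ℝ} (h : HasCompactSupport φ) : ∃ R, ∀ x, φ x ≠ 0 → ‖x‖ ≤ R := by
  obtain ⟨R, hR⟩ := h.isCompact.isBounded.exists_norm_le
  exact ⟨R, fun x hx => hR x (subset_tsupport φ hx)⟩

theorem integral_finsum_of_ae_eq_zero {J α : Type*} [Countable J] [MeasurableSpace α]
    {ν : Measure α} {g : J → α → ℝ} (hg : ∀ j, Integrable (g j) ν) {F : Set J} (hF : F.Finite)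
    (h : ∀ j, j ∉ F → g j =ᵐ[ν] 0) :
    ∫ x, ∑ᶠ j, g j x ∂ν = ∑ᶠ j, ∫ x, g j x ∂ν := by
  have hae : ∀ᵐ x ∂ν, ∀ j, j ∉ F → g j x = 0 := by
    rw [ae_all_iff]
    intro j
    by_cases hj : j ∈ F
    · exact Filter.Eventually.of_forall fun x hx => absurd hj hx
    · filter_upwards [h j hj] with x hx _ using hx
  have h1 : ∑ᶠ j, ∫ x, g j x ∂ν = ∑ j ∈ hF.toFinset, ∫ x, g j x ∂ν := by
    refine finsum_eq_sum_of_support_subset _ fun j hj => ?_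
    by_contra hjF
    exact hj (integral_eq_zero_of_ae (h j (by simpa using hjF)))
  rw [h1, ← integral_finsetSum _ fun j _ => hg j]
  refine integral_congr_ae ?_
  filter_upwards [hae] with x hx
  refine finsum_eq_sum_of_support_subset _ fun j hj => ?_
  by_contra hjF
  exact hj (hx j (by simpa using hjF))

/-- The normalized one-dimensional measure on `(-1/2, 1/2]`. -/
noncomputable def unitIntervalMeasure : Measure ℝ :=
  volume.restrict (Set.Ioc (-(1:ℝ)/2) (1/2))

instance : IsProbabilityMeasure unitIntervalMeasure :=
  ⟨by simp [unitIntervalMeasure]; norm_num⟩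

theorem integral_unitIntervalMeasure (f : ℝ → ℝ) :
    ∫ t, f t ∂unitIntervalMeasure = ∫ t in (-(1:ℝ)/2)..(1/2), f t := by
  rw [intervalIntegral.integral_of_le (by norm_num), unitIntervalMeasure]

/-- Lebesgue measure on the centered unit cube of `ι → ℝ`. -/
noncomputable def cubeMeasure (ι : Type*) [Fintype ι] : Measure (ι → ℝ) :=
  Measure.pi fun _ => unitIntervalMeasure

section Cube

variable {ι : Type*} [Fintype ι]

instance : IsProbabilityMeasure (cubeMeasure ι) := by
  unfold cubeMeasure; infer_instance

theorem cubeMeasure_eq_restrict :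
    cubeMeasure ι = volume.restrict (Set.univ.pi fun _ : ι => Set.Ioc (-(1:ℝ)/2) (1/2)) := by
  rw [volume_pi, Measure.restrict_pi_pi]; rfl

theorem ae_cubeMeasure : ∀ᵐ t ∂cubeMeasure ι, ∀ i, t i ∈ Set.Icc (-(1:ℝ)/2) (1/2) := by
  rw [cubeMeasure_eq_restrict]
  filter_upwards [ae_restrict_mem (MeasurableSet.univ_pi fun _ => measurableSet_Ioc)] with t ht i
  exact Set.Ioc_subset_Icc_self (ht i trivial)

theorem Continuous.integrable_cubeMeasure {G : (ι → ℝ) → ℝ} (hG : Continuous G) :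
    Integrable G (cubeMeasure ι) := by
  rw [cubeMeasure_eq_restrict]
  refine IntegrableOn.mono_set (t := Set.univ.pi fun _ : ι => Set.Icc (-(1:ℝ)/2) (1/2)) ?_
    (Set.pi_mono fun _ _ => Set.Ioc_subset_Icc_self)
  exact hG.continuousOn.integrableOn_compact (isCompact_univ_pi fun _ => isCompact_Icc)

variable [DecidableEq ι]

theorem map_update_cubeMeasure (i : ι) :
    ((cubeMeasure ι).prod unitIntervalMeasure).map (fun p => Function.update p.1 i p.2) =
      cubeMeasure ι := by
  symm
  refine Measure.pi_eq fun s hs => ?_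
  have hm : Measurable fun p : (ι → ℝ) × ℝ => Function.update p.1 i p.2 := by
    refine measurable_pi_lambda _ fun j => ?_
    by_cases hj : j = i
    · subst hj; simpa using measurable_snd
    · simp only [Function.update_of_ne hj]
      fun_prop
  rw [Measure.map_apply hm (MeasurableSet.univ_pi hs)]
  have : (fun p : (ι → ℝ) × ℝ => Function.update p.1 i p.2) ⁻¹' Set.univ.pi s =
      (Set.univ.pi (Function.update s i Set.univ)) ×ˢ s i := by
    ext p
    simp only [Set.mem_preimage, Set.mem_pi, Set.mem_univ, true_implies, Set.mem_prod]
    constructor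
    · intro h
      refine ⟨fun j => ?_, by simpa using h i⟩
      by_cases hj : j = i
      · subst hj; simp
      · simpa [hj] using h j
    · rintro ⟨h, hi⟩ j
      by_cases hj : j = i
      · subst hj; simpa using hi
      · simpa [hj] using h j
  rw [this, Measure.prod_prod, cubeMeasure, Measure.pi_pi,
    ← Finset.mul_prod_erase _ _ (Finset.mem_univ i),
    ← Finset.mul_prod_erase _ (fun j => unitIntervalMeasure (s j)) (Finset.mem_univ i)]
  simp only [Function.update_self, measure_univ, one_mul]
  rw [mul_comm]
  congr 1
  refine Finset.prod_congr rfl fun j hj => ?_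
  rw [Function.update_of_ne (Finset.ne_of_mem_erase hj)]

/-- Integration over the cube can be done by first integrating out a single coordinate. -/
theorem integral_cubeMeasure_update {G : (ι → ℝ) → ℝ} (hG : Continuous G) (i : ι) :
    ∫ t, G t ∂cubeMeasure ι =
      ∫ t, (∫ s in (-(1:ℝ)/2)..(1/2), G (Function.update t i s)) ∂cubeMeasure ι := by
  have hc : Continuous fun p : (ι → ℝ) × ℝ => Function.update p.1 i p.2 :=
    continuous_fst.update i continuous_snd
  have hint := hG.integrable_cubeMeasure
  rw [← map_update_cubeMeasure i] at hint
  conv_lhs => rw [← map_update_cubeMeasure i]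
  rw [integral_map hc.aemeasurable hG.aestronglyMeasurable,
    integral_prod (fun p : (ι → ℝ) × ℝ => G (Function.update p.1 i p.2))
      (hint.comp_measurable hc.measurable)]
  simp only [integral_unitIntervalMeasure]

end Cube

theorem sum_update_smul {ι E : Type*} [DecidableEq ι] [AddCommGroup E] [Module ℝ E]
    (ξ : ι → E) {S : Finset ι} {i : ι} (hi : i ∈ S) (t : ι → ℝ) (s : ℝ) :
    ∑ j ∈ S, Function.update t i s j • ξ j = ∑ j ∈ S.erase i, t j • ξ j + s • ξ i := by
  rw [← Finset.sum_erase_add _ _ hi, Function.update_self]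
  congr 1
  refine Finset.sum_congr rfl fun j hj => ?_
  rw [Function.update_of_ne (Finset.ne_of_mem_erase hj)]

/-- The average of `φ` over the image of the centered unit cube under
`t ↦ ∑ i ∈ S, t i • ξ i`. -/
noncomputable def cubeAverage {ι E : Type*} [Fintype ι] [NormedAddCommGroup E] [NormedSpace ℝ E]
    (ξ : ι → E) (S : Finset ι) (φ : E → ℝ) : ℝ :=
  ∫ t, φ (∑ i ∈ S, t i • ξ i) ∂cubeMeasure ι

section CubeAverage

variable {ι E : Type*} [Fintype ι] [DecidableEq ι] [NormedAddCommGroup E] [NormedSpace ℝ E]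

theorem cubeAverage_eq_integral_intervalIntegral (ξ : ι → E) {S : Finset ι} {i : ι} (hi : i ∈ S)
    {φ : E → ℝ} (hφ : Continuous φ) :
    cubeAverage ξ S φ =
      ∫ t, (∫ s in (-(1:ℝ)/2)..(1/2), φ (∑ j ∈ S.erase i, t j • ξ j + s • ξ i))
        ∂cubeMeasure ι := by
  rw [cubeAverage, integral_cubeMeasure_update
    (G := fun t => φ (∑ j ∈ S, t j • ξ j)) (by fun_prop) i]
  simp only [sum_update_smul ξ hi]

/-- The directional derivative along a direction of the cube turns the average into a
difference of averages over a facet. -/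
theorem cubeAverage_fderiv (ξ : ι → E) {S : Finset ι} {i : ι} (hi : i ∈ S)
    {φ : E → ℝ} (hφ : ContDiff ℝ 1 φ) :
    cubeAverage ξ S (fun y => fderiv ℝ φ y (ξ i)) =
      cubeAverage ξ (S.erase i) (fun y => φ (y + (1/2 : ℝ) • ξ i)) -
        cubeAverage ξ (S.erase i) (fun y => φ (y + (-1/2 : ℝ) • ξ i)) := by
  have hD : Continuous fun y => fderiv ℝ φ y (ξ i) :=
    (hφ.continuous_fderiv one_ne_zero).clm_apply continuous_const
  have hint : ∀ v : E, Integrable (fun t : ι → ℝ => φ (∑ j ∈ S.erase i, t j • ξ j + v))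
      (cubeMeasure ι) := fun v => by
    have := hφ.continuous
    exact Continuous.integrable_cubeMeasure (by fun_prop)
  rw [cubeAverage_eq_integral_intervalIntegral ξ hi hD, cubeAverage, cubeAverage,
    ← integral_sub (hint _) (hint _)]
  refine integral_congr_ae (Filter.Eventually.of_forall fun t => ?_)
  refine intervalIntegral.integral_eq_sub_of_hasDerivAt
    (f := fun s : ℝ => φ (∑ j ∈ S.erase i, t j • ξ j + s • ξ i)) (fun s _ => ?_) ?_
  · have h1 : HasDerivAt (fun s : ℝ => ∑ j ∈ S.erase i, t j • ξ j + s • ξ i) (ξ i) s := by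
      simpa using ((hasDerivAt_id s).smul_const (ξ i)).const_add (∑ j ∈ S.erase i, t j • ξ j)
    exact ((hφ.differentiable one_ne_zero _).hasFDerivAt).comp_hasDerivAt s h1
  · exact Continuous.intervalIntegrable (by fun_prop) _ _

/-- Averages of a function which is `1`-periodic along a direction of the cube are invariant under
all translations in that direction. -/
theorem cubeAverage_add_smul (ξ : ι → E) {S : Finset ι} {i : ι} (hi : i ∈ S)
    {Φ : E → ℝ} (hΦ : Continuous Φ) (hper : ∀ y, Φ (y + ξ i) = Φ y) (r : ℝ) :
    cubeAverage ξ S (fun y => Φ (y + r • ξ i)) = cubeAverage ξ S Φ := by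
  rw [cubeAverage_eq_integral_intervalIntegral ξ hi hΦ,
    cubeAverage_eq_integral_intervalIntegral ξ hi (by fun_prop)]
  congr 1
  ext t
  set w := ∑ j ∈ S.erase i, t j • ξ j
  have hp : Function.Periodic (fun s : ℝ => Φ (w + s • ξ i)) 1 := fun s => by
    simp only [add_smul, one_smul, ← add_assoc, hper]
  have h := hp.intervalIntegral_add_eq (-(1:ℝ)/2 + r) (-(1:ℝ)/2)
  have e1 : (-(1:ℝ)/2 + r + 1) = 1/2 + r := by ring
  have e2 : (-(1:ℝ)/2 + 1) = 1/2 := by ring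
  rw [e1, e2, ← intervalIntegral.integral_comp_add_right (fun s => Φ (w + s • ξ i))] at h
  simpa only [add_assoc, add_smul] using h

end CubeAverage

section Shifts

variable {ι : Type*} [Fintype ι] {d : ℕ}

theorem exists_finite_forall_notMem_ae_eq_zero (ξ : ι → Fin d → ℝ) (S : Finset ι)
    {φ : (Fin d → ℝ) → ℝ} (hφ : HasCompactSupport φ) :
    ∃ F : Set (Fin d → ℤ), F.Finite ∧ ∀ j, j ∉ F →
      (fun t : ι → ℝ => φ (∑ i ∈ S, t i • ξ i + intCastVec d j)) =ᵐ[cubeMeasure ι] 0 := by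
  obtain ⟨R, hR⟩ := hφ.exists_norm_le_of_ne_zero
  refine ⟨_, finite_setOf_norm_intCastVec_le d (R + ∑ i ∈ S, ‖ξ i‖), fun j hj => ?_⟩
  filter_upwards [ae_cubeMeasure] with t ht
  by_contra hne
  refine hj ?_
  have h1 := hR _ hne
  have h2 : ‖∑ i ∈ S, t i • ξ i‖ ≤ ∑ i ∈ S, ‖ξ i‖ := by
    refine norm_sum_le_of_le _ fun i _ => ?_
    rw [norm_smul]
    refine mul_le_of_le_one_left (norm_nonneg _) ?_
    rw [Real.norm_eq_abs, abs_le]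
    obtain ⟨h3, h4⟩ := ht i
    constructor <;> linarith
  have h3 := norm_sub_le (∑ i ∈ S, t i • ξ i + intCastVec d j) (∑ i ∈ S, t i • ξ i)
  rw [add_sub_cancel_left] at h3
  simp only [Set.mem_ofPred_eq]
  linarith

theorem finite_support_cubeAverage_add (ξ : ι → Fin d → ℝ) (S : Finset ι)
    {φ : (Fin d → ℝ) → ℝ} (hφ : HasCompactSupport φ) :
    (Function.support fun j => cubeAverage ξ S fun y => φ (y + intCastVec d j)).Finite := by
  obtain ⟨F, hF, h⟩ := exists_finite_forall_notMem_ae_eq_zero ξ S hφ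
  refine hF.subset fun j hj => ?_
  by_contra hjF
  exact hj (integral_eq_zero_of_ae (h j hjF))

/-- The weak form of the assertion that the coefficients `c` give a vanishing linear combination of
the lattice shifts of the box spline with directions `ξ i`, `i ∈ S`. -/
def WeaklyVanishing (ξ : ι → Fin d → ℤ) (S : Finset ι) (c : (Fin d → ℤ) → ℝ) : Prop :=
  ∀ φ : (Fin d → ℝ) → ℝ, ContDiff ℝ ((⊤ : ℕ∞) : WithTop ℕ∞) φ → HasCompactSupport φ →
    ∑ᶠ j, c j * cubeAverage (fun i => intCastVec d (ξ i)) S (fun y => φ (y + intCastVec d j)) = 0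

theorem HasCompactSupport.comp_add_right {E : Type*} [TopologicalSpace E] [AddGroup E]
    [ContinuousAdd E] {φ : E → ℝ} (h : HasCompactSupport φ) (v : E) :
    HasCompactSupport fun y => φ (y + v) :=
  h.comp_homeomorph (Homeomorph.addRight v)

theorem WeaklyVanishing.erase [DecidableEq ι] {ξ : ι → Fin d → ℤ} {S : Finset ι}
    {c : (Fin d → ℤ) → ℝ} (h : WeaklyVanishing ξ S c) {i : ι} (hi : i ∈ S) :
    WeaklyVanishing ξ (S.erase i) fun j => c (j - ξ i) - c j := by
  intro φ hφ hφc
  set η : ι → Fin d → ℝ := fun i => intCastVec d (ξ i) with hη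
  set a : (Fin d → ℤ) → ℝ := fun j =>
    cubeAverage η (S.erase i) fun y => φ (y + intCastVec d j) with ha
  set ψ : (Fin d → ℝ) → ℝ := fun y => φ (y + (1/2 : ℝ) • η i) with hψ
  have hψs : ContDiff ℝ ((⊤ : ℕ∞) : WithTop ℕ∞) ψ := by fun_prop
  have hψc : HasCompactSupport ψ := hφc.comp_add_right _
  have key := h (fun y => fderiv ℝ ψ y (η i))
    ((hψs.fderiv_right (by simp)).clm_apply contDiff_const) (hψc.fderiv_apply ℝ _)
  have e : ∀ j, cubeAverage η S (fun y => fderiv ℝ ψ (y + intCastVec d j) (η i)) =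
      a (j + ξ i) - a j := by
    intro j
    have h1 : (fun y => fderiv ℝ ψ (y + intCastVec d j) (η i)) =
        fun y => fderiv ℝ (fun z => ψ (z + intCastVec d j)) y (η i) := by
      ext y
      exact (congrArg (fun L : (Fin d → ℝ) →L[ℝ] ℝ => L (η i)) (fderiv_comp_add_right (f := ψ) _)).symm
    rw [h1, cubeAverage_fderiv η hi]
    · simp only [ha, hψ, map_add]
      congr 2
      · ext y; congr 1; simp only [hη]; module
      · ext y; congr 1; module
    · exact (hψs.of_le (by exact_mod_cast le_top)).comp (contDiff_id.add contDiff_const)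
  simp only [← hη, e] at key
  have hfin : (Function.support a).Finite := finite_support_cubeAverage_add η _ hφc
  have hr : ∑ᶠ j, c j * a (j + ξ i) = ∑ᶠ j, c (j - ξ i) * a j := by
    rw [← finsum_comp_equiv (Equiv.addRight (ξ i)) (f := fun j => c (j - ξ i) * a j)]
    simp
  have f1 : (Function.support fun j => c j * a (j + ξ i)).Finite := by
    refine (hfin.preimage ((add_left_injective (ξ i)).injOn)).subset fun j hj => ?_
    exact right_ne_zero_of_mul hj
  have f2 : ∀ b : (Fin d → ℤ) → ℝ, (Function.support fun j => b j * a j).Finite := fun b =>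
    hfin.subset fun j hj => right_ne_zero_of_mul hj
  calc ∑ᶠ j, (c (j - ξ i) - c j) * a j = ∑ᶠ j, (c (j - ξ i) * a j - c j * a j) := by
        simp only [sub_mul]
    _ = ∑ᶠ j, (c j * a (j + ξ i) - c j * a j) := by
        rw [finsum_sub_distrib (f2 _) (f2 _), finsum_sub_distrib f1 (f2 _), hr]
    _ = 0 := by simpa only [mul_sub] using key

theorem exists_injective_det_ne_zero_of_span_eq_top {ι : Type*} (v : ι → Fin d → ℝ) (S : Finset ι)
    (hS : Submodule.span ℝ (v '' S) = ⊤) :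
    ∃ f : Fin d → ι, Function.Injective f ∧ (∀ k, f k ∈ S) ∧
      (Matrix.of fun i k => v (f k) i).det ≠ 0 := by
  obtain ⟨κ, a, ha, hspan, hli⟩ := exists_linearIndependent' ℝ (fun i : S => v i)
  have htop : ⊤ ≤ Submodule.span ℝ (Set.range ((fun i : S => v i) ∘ a)) := by
    rw [hspan, ← hS, Set.image_eq_range]
    rfl
  let b := Module.Basis.mk hli htop
  let e : Fin d ≃ κ := (Pi.basisFun ℝ (Fin d)).indexEquiv b
  refine ⟨fun k => a (e k), fun x y hxy => e.injective (ha (Subtype.ext hxy)),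
    fun k => (a (e k)).2, ?_⟩
  have hli' : LinearIndependent ℝ fun k : Fin d => v (a (e k)) := hli.comp e e.injective
  have hu := (Matrix.linearIndependent_rows_iff_isUnit
    (A := Matrix.of fun k i => v (a (e k)) i)).1 hli'
  rw [Matrix.isUnit_iff_isUnit_det, isUnit_iff_ne_zero, ← Matrix.det_transpose] at hu
  exact hu

theorem det_intCastVec_eq {ι : Type*} (ξ : ι → Fin d → ℤ) (f : Fin d → ι) :
    (Matrix.of fun i k => intCastVec d (ξ (f k)) i).det =
      ((Matrix.of fun i k => ξ (f k) i).det : ℝ) :=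
  ((Int.castRingHom ℝ).map_det (Matrix.of fun i k => ξ (f k) i)).symm

theorem exists_dual_of_span_erase_ne_top {ι : Type*} [DecidableEq ι] (v : ι → Fin d → ℝ) {S : Finset ι}
    (hS : Submodule.span ℝ (v '' S) = ⊤) {i : ι} (hi : i ∈ S)
    (h : Submodule.span ℝ (v '' (S.erase i)) ≠ ⊤) :
    ∃ l : (Fin d → ℝ) →ₗ[ℝ] ℝ, l (v i) = 1 ∧ ∀ k ∈ S, k ≠ i → l (v k) = 0 := by
  obtain ⟨l, hl, hle⟩ := Submodule.exists_le_ker_of_lt_top _ (lt_top_iff_ne_top.2 h)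
  have hk : ∀ k ∈ S, k ≠ i → l (v k) = 0 := fun k hk hki =>
    hle (Submodule.subset_span ⟨k, by simp [hk, hki], rfl⟩)
  have hi0 : l (v i) ≠ 0 := fun h0 => by
    refine hl (LinearMap.ker_eq_top.1 (top_le_iff.1 ?_))
    rw [← hS, Submodule.span_le]
    rintro _ ⟨k, hkS, rfl⟩
    by_cases hki : k = i
    · subst hki; exact h0
    · exact hk k hkS hki
  refine ⟨(l (v i))⁻¹ • l, by simp [hi0], fun k hkS hki => by simp [hk k hkS hki]⟩

theorem cubeAverage_nonneg (ξ : ι → Fin d → ℝ) (S : Finset ι) {φ : (Fin d → ℝ) → ℝ}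
    (h : ∀ x, 0 ≤ φ x) : 0 ≤ cubeAverage ξ S φ :=
  integral_nonneg fun _ => h _

theorem cubeAverage_pos (ξ : ι → Fin d → ℝ) (S : Finset ι) {φ : (Fin d → ℝ) → ℝ}
    (hc : Continuous φ) (h : ∀ x, 0 ≤ φ x) (h0 : 0 < φ 0) : 0 < cubeAverage ξ S φ := by
  have hG : Continuous fun t : ι → ℝ => φ (∑ i ∈ S, t i • ξ i) := by fun_prop
  rw [cubeAverage, integral_pos_iff_support_of_nonneg (fun _ => h _) hG.integrable_cubeMeasure,
    cubeMeasure_eq_restrict]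
  set U := Function.support fun t : ι → ℝ => φ (∑ i ∈ S, t i • ξ i) with hU
  set V := Set.univ.pi fun _ : ι => Set.Ioo (-(1:ℝ)/2) (1/2) with hV
  have hUo : IsOpen U := hG.isOpen_support
  have hVo : IsOpen V := isOpen_set_pi Set.finite_univ fun _ _ => isOpen_Ioo
  have hne : (U ∩ V).Nonempty :=
    ⟨0, by simpa [hU] using h0.ne', fun _ _ => by constructor <;> norm_num⟩
  refine ((hUo.inter hVo).measure_pos volume hne).trans_le ?_
  rw [Measure.restrict_apply hUo.measurableSet]
  exact measure_mono (Set.inter_subset_inter_right _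
    (Set.pi_mono fun _ _ => Set.Ioo_subset_Ioc_self))

/-- If all nonsingular square submatrices have determinant `±1`, then only the zero coefficients
give a weakly vanishing combination of shifts. -/
theorem WeaklyVanishing.eq_zero [DecidableEq ι] {ξ : ι → Fin d → ℤ}
    (hU : ∀ f : Fin d → ι, Function.Injective f → (Matrix.of fun i k => ξ (f k) i).det ≠ 0 →
      |(Matrix.of fun i k => ξ (f k) i).det| = 1) (S : Finset ι) :
    Submodule.span ℝ ((fun i => intCastVec d (ξ i)) '' S) = ⊤ →
      ∀ c : (Fin d → ℤ) → ℝ, WeaklyVanishing ξ S c → ∀ j, c j = 0 := by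
  induction S using Finset.strongInduction with
  | H S ih =>
  intro hS c hc j₀
  set η : ι → Fin d → ℝ := fun i => intCastVec d (ξ i) with hη
  have hper : ∀ i ∈ S, Submodule.span ℝ (η '' (S.erase i)) = ⊤ → ∀ j, c (j + ξ i) = c j := by
    intro i hi hspan j
    have := ih _ (Finset.erase_ssubset hi) hspan _ (hc.erase hi) (j + ξ i)
    rw [add_sub_cancel_right] at this
    linarith
  have hdual : ∀ i, ∃ l : (Fin d → ℝ) →ₗ[ℝ] ℝ, i ∈ S →
      Submodule.span ℝ (η '' (S.erase i)) ≠ ⊤ →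
      l (η i) = 1 ∧ ∀ k ∈ S, k ≠ i → l (η k) = 0 := by
    intro i
    by_cases h : i ∈ S ∧ Submodule.span ℝ (η '' (S.erase i)) ≠ ⊤
    · obtain ⟨l, hl⟩ := exists_dual_of_span_erase_ne_top η hS h.1 h.2
      exact ⟨l, fun _ _ => hl⟩
    · exact ⟨0, fun h1 h2 => absurd ⟨h1, h2⟩ h⟩
  choose l hl using hdual
  obtain ⟨f, hf, hfS, hdet⟩ := exists_injective_det_ne_zero_of_span_eq_top η S hS
  have hsurj : Function.Surjective (Matrix.of fun i k => ξ (f k) i).mulVec := by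
    rw [Matrix.mulVec_surjective_iff_isUnit, Matrix.isUnit_iff_isUnit_det, Int.isUnit_iff_abs_eq]
    refine hU f hf fun h0 => hdet ?_
    rw [det_intCastVec_eq, h0, Int.cast_zero]
  have hW : (⋂ i, {y : Fin d → ℝ | |l i y| < 1/2}) ∈ nhds (0 : Fin d → ℝ) := by
    rw [Filter.iInter_mem]
    intro i
    refine (isOpen_lt ((l i).continuous_of_finiteDimensional.abs) continuous_const).mem_nhds ?_
    simp
  obtain ⟨ψ, hψW, hψc, hψs, hψr, hψ0⟩ := exists_contDiff_tsupport_subset (n := ⊤) hW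
  have hψnn : ∀ x, 0 ≤ ψ x := fun x => (hψr ⟨x, rfl⟩).1
  -- a lattice point whose shift meets the support of `ψ` differs from `0` by a period of `c`
  have hconst : ∀ k : Fin d → ℤ, cubeAverage η S (fun y => ψ (y + intCastVec d k)) ≠ 0 →
      c (j₀ + k) = c j₀ := by
    intro k hk
    obtain ⟨t, htc, ht⟩ : ∃ t : ι → ℝ, (∀ i, t i ∈ Set.Icc (-(1:ℝ)/2) (1/2)) ∧
        ψ (∑ i ∈ S, t i • η i + intCastVec d k) ≠ 0 := by
      by_contra! hcon
      refine hk (integral_eq_zero_of_ae ?_)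
      filter_upwards [ae_cubeMeasure] with t ht using hcon t ht
    have hin := hψW (subset_tsupport ψ ht)
    obtain ⟨α, rfl⟩ := hsurj k
    have hkα : (Matrix.of fun i k => ξ (f k) i).mulVec α = ∑ p, α p • ξ (f p) := by
      ext i
      simp [Matrix.mulVec, dotProduct, Finset.sum_apply, mul_comm]
    have hα : ∀ p, Submodule.span ℝ (η '' (S.erase (f p))) ≠ ⊤ → α p = 0 := by
      intro p hp
      obtain ⟨h1, h2⟩ := hl (f p) (hfS p) hp
      have hlt := Set.mem_iInter.1 hin (f p)
      have e1 : l (f p) (∑ i ∈ S, t i • η i) = t (f p) := by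
        rw [map_sum, Finset.sum_eq_single_of_mem _ (hfS p)]
        · simp [h1]
        · intro b hb hbp; simp [h2 b hb hbp]
      have e2 : l (f p) (intCastVec d ((Matrix.of fun i k => ξ (f k) i).mulVec α)) = α p := by
        rw [hkα, map_sum, map_sum, Finset.sum_eq_single_of_mem p (Finset.mem_univ p)]
        · rw [map_zsmul, map_zsmul]
          change α p • l (f p) (η (f p)) = _
          simp [h1]
        · intro b _ hbp
          rw [map_zsmul, map_zsmul]
          change α b • l (f p) (η (f b)) = _
          simp [h2 _ (hfS b) (fun h => hbp (hf h))]
      simp only [Set.mem_ofPred_eq, map_add, e1, e2] at hlt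
      obtain ⟨h3, h4⟩ := htc (f p)
      obtain ⟨h5, h6⟩ := abs_lt.1 hlt
      have h7 : (α p : ℝ) < 1 := by linarith
      have h8 : (-1 : ℝ) < α p := by linarith
      have h9 : α p < 1 := by exact_mod_cast h7
      have h10 : -1 < α p := by exact_mod_cast h8
      omega
    let Λ : AddSubgroup (Fin d → ℤ) :=
      { carrier := {v | ∀ j, c (j + v) = c j}
        zero_mem' := fun j => by simp
        add_mem' := fun {a b} ha hb j => by rw [← add_assoc, hb, ha]
        neg_mem' := fun {a} ha j => by rw [← ha (j + -a), neg_add_cancel_right] }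
    have hmem : ∑ p, α p • ξ (f p) ∈ Λ := by
      refine sum_mem fun p _ => ?_
      by_cases hp : Submodule.span ℝ (η '' (S.erase (f p))) = ⊤
      · exact zsmul_mem (show ξ (f p) ∈ Λ from hper _ (hfS p) hp) _
      · rw [hα p hp, zero_smul]; exact zero_mem _
    rw [hkα]
    exact hmem j₀
  have hsum := hc (fun y => ψ (y + -intCastVec d j₀))
    (hψs.comp (contDiff_id.add contDiff_const)) (hψc.comp_add_right _)
  rw [← finsum_comp_equiv (Equiv.addLeft j₀)] at hsum
  set a : (Fin d → ℤ) → ℝ := fun k => cubeAverage η S (fun y => ψ (y + intCastVec d k)) with ha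
  have e : ∀ k, c (Equiv.addLeft j₀ k) * cubeAverage η S
      (fun y => ψ (y + intCastVec d (Equiv.addLeft j₀ k) + -intCastVec d j₀)) = c j₀ * a k := by
    intro k
    have e1 : ∀ y, y + intCastVec d (Equiv.addLeft j₀ k) + -intCastVec d j₀ =
        y + intCastVec d k := fun y => by
      rw [Equiv.coe_addLeft, map_add]; abel
    simp only [e1]
    change c (j₀ + k) * a k = _
    by_cases hk : a k = 0
    · simp [hk]
    · rw [hconst k hk]
  simp only [← hη, e] at hsum
  rw [← mul_finsum] at hsum
  refine (mul_eq_zero.1 hsum).resolve_right (ne_of_gt ?_)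
  refine finsum_pos (fun k => cubeAverage_nonneg _ _ fun _ => hψnn _) ⟨0, ?_⟩
    (finite_support_cubeAverage_add η S hψc)
  refine cubeAverage_pos _ _ (hψs.continuous.comp (by fun_prop)) (fun _ => hψnn _) ?_
  simp [hψ0]

end Shifts

section BoxSpline

variable {d : ℕ}

/-- The square matrix formed by the first `d` columns. -/
def firstColumns {n : ℕ} (Ξ : Matrix (Fin d) (Fin (d + n)) ℝ) : Matrix (Fin d) (Fin d) ℝ :=
  Matrix.of fun i j => Ξ i (Fin.castAdd n j)

theorem boxSplineAux_zero {Ξ : Matrix (Fin d) (Fin (d + 0)) ℝ} (h : (firstColumns Ξ).det ≠ 0)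
    (x : Fin d → ℝ) :
    boxSplineAux d 0 Ξ x =
      Set.indicator {y | ∀ i, ((firstColumns Ξ)⁻¹.mulVec y) i ∈ Set.Ico (-(1:ℝ)/2) (1/2)}
        (fun _ => |(firstColumns Ξ).det|⁻¹) x := by
  have hu : IsUnit (firstColumns Ξ).det := isUnit_iff_ne_zero.2 h
  have hset : {y : Fin d → ℝ | ∃ t : Fin d → ℝ, (∀ i, t i ∈ Set.Ico (-(1:ℝ)/2) (1/2)) ∧
      y = (firstColumns Ξ).mulVec t} =
      {y | ∀ i, ((firstColumns Ξ)⁻¹.mulVec y) i ∈ Set.Ico (-(1:ℝ)/2) (1/2)} := by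
    ext y
    constructor
    · rintro ⟨t, ht, rfl⟩ i
      rw [Matrix.mulVec_mulVec, Matrix.nonsing_inv_mul _ hu, Matrix.one_mulVec]
      exact ht i
    · intro hy
      refine ⟨_, hy, ?_⟩
      rw [Matrix.mulVec_mulVec, Matrix.mul_nonsing_inv _ hu, Matrix.one_mulVec]
  rw [← hset]
  rfl

theorem boxSplineAux_succ {n : ℕ} (Ξ : Matrix (Fin d) (Fin (d + (n + 1))) ℝ) (x : Fin d → ℝ) :
    boxSplineAux d (n + 1) Ξ x = ∫ t in (-(1:ℝ)/2)..(1/2),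
      boxSplineAux d n (fun i j => Ξ i (Fin.castSucc j))
        (x - t • fun i => Ξ i (Fin.last (d + n))) := rfl

theorem measurable_boxSplineAux {n : ℕ} {Ξ : Matrix (Fin d) (Fin (d + n)) ℝ}
    (h : (firstColumns Ξ).det ≠ 0) : Measurable (boxSplineAux d n Ξ) := by
  induction n with
  | zero =>
    rw [funext (boxSplineAux_zero h)]
    refine measurable_const.indicator ?_
    rw [Set.ofPred_forall]
    refine MeasurableSet.iInter fun i => ?_
    have hc : Continuous fun y => ((firstColumns Ξ)⁻¹.mulVec y) i := by
      unfold Matrix.mulVec dotProduct; fun_prop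
    exact hc.measurable measurableSet_Ico
  | succ n ih =>
    rw [funext (boxSplineAux_succ Ξ)]
    simp only [← integral_unitIntervalMeasure]
    refine (StronglyMeasurable.integral_prod_right (Measurable.stronglyMeasurable ?_)).measurable
    refine (ih (Ξ := fun i j => Ξ i (Fin.castSucc j)) h).comp ?_
    fun_prop

theorem exists_abs_boxSplineAux_le {n : ℕ} {Ξ : Matrix (Fin d) (Fin (d + n)) ℝ}
    (h : (firstColumns Ξ).det ≠ 0) : ∃ B, ∀ x, |boxSplineAux d n Ξ x| ≤ B := by
  induction n with
  | zero =>
    refine ⟨|(firstColumns Ξ).det|⁻¹, fun x => ?_⟩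
    rw [boxSplineAux_zero h]
    refine (norm_indicator_le_norm_self (fun _ => |(firstColumns Ξ).det|⁻¹) x).trans_eq ?_
    simp
  | succ n ih =>
    obtain ⟨B, hB⟩ := ih (Ξ := fun i j => Ξ i (Fin.castSucc j)) h
    refine ⟨B, fun x => ?_⟩
    rw [boxSplineAux_succ]
    refine (intervalIntegral.norm_integral_le_of_norm_le_const (C := B)
      fun t _ => (Real.norm_eq_abs _).trans_le (hB _)).trans_eq ?_
    norm_num

theorem exists_norm_le_of_boxSplineAux_ne_zero {n : ℕ} (Ξ : Matrix (Fin d) (Fin (d + n)) ℝ) :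
    ∃ R, ∀ x, boxSplineAux d n Ξ x ≠ 0 → ‖x‖ ≤ R := by
  induction n with
  | zero =>
    have hK : IsCompact ((firstColumns Ξ).mulVec ''
        Set.univ.pi fun _ : Fin d => Set.Icc (-(1:ℝ)/2) (1/2)) := by
      refine (isCompact_univ_pi fun _ => isCompact_Icc).image ?_
      unfold Matrix.mulVec dotProduct; fun_prop
    obtain ⟨R, hR⟩ := hK.isBounded.exists_norm_le
    refine ⟨R, fun x hx => hR x ?_⟩
    obtain ⟨t, ht, rfl⟩ : x ∈ {y : Fin d → ℝ | ∃ t : Fin d → ℝ,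
        (∀ i, t i ∈ Set.Ico (-(1:ℝ)/2) (1/2)) ∧ y = (firstColumns Ξ).mulVec t} :=
      Set.mem_of_indicator_ne_zero (f := fun _ => |(firstColumns Ξ).det|⁻¹) hx
    exact ⟨t, fun i _ => Set.Ico_subset_Icc_self (ht i), rfl⟩
  | succ n ih =>
    obtain ⟨R, hR⟩ := ih fun i j => Ξ i (Fin.castSucc j)
    refine ⟨R + ‖fun i => Ξ i (Fin.last (d + n))‖, fun x hx => ?_⟩
    by_contra hlt
    refine hx ?_
    rw [boxSplineAux_succ]
    refine intervalIntegral.integral_zero_ae (Filter.Eventually.of_forall fun t ht => ?_)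
    by_contra hne
    have h1 := hR _ hne
    rw [Set.uIoc_of_le (by norm_num)] at ht
    have h2 : ‖t • fun i => Ξ i (Fin.last (d + n))‖ ≤ ‖fun i => Ξ i (Fin.last (d + n))‖ := by
      rw [norm_smul]
      refine mul_le_of_le_one_left (norm_nonneg _) ?_
      rw [Real.norm_eq_abs, abs_le]
      constructor <;> linarith [ht.1, ht.2]
    have h3 := norm_sub_norm_le x (t • fun i => Ξ i (Fin.last (d + n)))
    linarith

/-- Box splines are continuous from within a suitable open cone. -/
theorem exists_tendsto_boxSplineAux {n : ℕ} {Ξ : Matrix (Fin d) (Fin (d + n)) ℝ}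
    (h : (firstColumns Ξ).det ≠ 0) :
    ∃ C : Set (Fin d → ℝ), IsOpen C ∧ 0 ∈ closure C ∧ ∀ x,
      Filter.Tendsto (fun y => boxSplineAux d n Ξ (x + y)) (nhdsWithin 0 C)
        (nhds (boxSplineAux d n Ξ x)) := by
  induction n with
  | zero =>
    set W := (firstColumns Ξ)⁻¹ with hW
    have hu : IsUnit (firstColumns Ξ).det := isUnit_iff_ne_zero.2 h
    have hc : ∀ i, Continuous fun y => (W.mulVec y) i := fun i => by
      unfold Matrix.mulVec dotProduct; fun_prop
    refine ⟨{y | ∀ i, 0 < (W.mulVec y) i}, ?_, ?_, fun x => ?_⟩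
    · rw [Set.ofPred_forall]
      exact isOpen_iInter_of_finite fun i => isOpen_lt continuous_const (hc i)
    · have hlim : Filter.Tendsto (fun k : ℕ => (1 / ((k : ℝ) + 1)) • (firstColumns Ξ).mulVec 1)
          Filter.atTop (nhds 0) := by
        simpa using (tendsto_one_div_add_atTop_nhds_zero_nat (𝕜 := ℝ)).smul_const
          ((firstColumns Ξ).mulVec 1)
      refine mem_closure_of_tendsto hlim (Filter.Eventually.of_forall fun k i => ?_)
      rw [Matrix.mulVec_smul, Matrix.mulVec_mulVec, hW, Matrix.nonsing_inv_mul _ hu,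
        Matrix.one_mulVec]
      simp only [Pi.smul_apply, Pi.one_apply, smul_eq_mul, mul_one]
      positivity
    · refine tendsto_const_nhds.congr' ?_
      have hev : ∀ i, ∀ᶠ y in nhdsWithin 0 {y | ∀ i, 0 < (W.mulVec y) i},
          ((W.mulVec x) i ∈ Set.Ico (-(1:ℝ)/2) (1/2) ↔
            (W.mulVec (x + y)) i ∈ Set.Ico (-(1:ℝ)/2) (1/2)) := by
        intro i
        have hlt : ∀ a b : ℝ, a < b → ∀ᶠ y in nhdsWithin (0 : Fin d → ℝ)
            {y | ∀ i, 0 < (W.mulVec y) i}, a + (W.mulVec y) i < b := by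
          intro a b hab
          refine Filter.Eventually.filter_mono nhdsWithin_le_nhds ?_
          refine ((continuous_const.add (hc i)).continuousAt).eventually_lt_const ?_
          simpa using hab
        have hmem := self_mem_nhdsWithin (a := (0 : Fin d → ℝ)) (s := {y | ∀ i, 0 < (W.mulVec y) i})
        by_cases h1 : (W.mulVec x) i < -(1:ℝ)/2
        · filter_upwards [hlt _ _ h1] with y hy
          rw [Matrix.mulVec_add, Pi.add_apply]
          exact iff_of_false (fun h => absurd h.1 (not_le.2 h1))
            fun h => absurd h.1 (not_le.2 hy)
        by_cases h2 : (W.mulVec x) i < 1/2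
        · filter_upwards [hlt _ _ h2, hmem] with y hy hy0
          have := hy0 i
          rw [Matrix.mulVec_add, Pi.add_apply]
          exact iff_of_true ⟨by linarith, h2⟩ ⟨by linarith, hy⟩
        · filter_upwards [hmem] with y hy0
          have := hy0 i
          rw [Matrix.mulVec_add, Pi.add_apply]
          refine iff_of_false (fun h => h2 h.2) fun h => ?_
          have := h.2
          linarith
      filter_upwards [Filter.eventually_all.2 hev] with y hy
      rw [boxSplineAux_zero h, boxSplineAux_zero h]
      simp only [Set.indicator, Set.mem_ofPred_eq, ← hW]
      exact if_congr (forall_congr' hy) rfl rfl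
  | succ n ih =>
    have h' : (firstColumns (n := n) fun i j => Ξ i (Fin.castSucc j)).det ≠ 0 := h
    obtain ⟨C, hC, h0, hlim⟩ := ih h'
    obtain ⟨B, hB⟩ := exists_abs_boxSplineAux_le h'
    have hm := measurable_boxSplineAux h'
    refine ⟨C, hC, h0, fun x => ?_⟩
    simp only [boxSplineAux_succ]
    refine intervalIntegral.tendsto_integral_filter_of_dominated_convergence (fun _ => B)
      (Filter.Eventually.of_forall fun y => ?_)
      (Filter.Eventually.of_forall fun y => Filter.Eventually.of_forall fun t _ => hB _)
      intervalIntegrable_const (Filter.Eventually.of_forall fun t _ => ?_)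
    · exact (hm.comp (by fun_prop)).aestronglyMeasurable
    · refine (hlim _).congr fun y => ?_
      rw [add_sub_right_comm]

theorem cubeAverage_succ {n : ℕ} {E : Type*} [NormedAddCommGroup E] [NormedSpace ℝ E]
    (ξ : Fin (n + 1) → E) {φ : E → ℝ} (hφ : Continuous φ) (hφc : HasCompactSupport φ) :
    cubeAverage ξ Finset.univ φ =
      ∫ s, cubeAverage (fun i => ξ (Fin.castSucc i)) Finset.univ
        (fun y => φ (y + s • ξ (Fin.last n))) ∂unitIntervalMeasure := by
  set H : ℝ × (Fin n → ℝ) → ℝ := fun p =>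
    φ (∑ i, p.2 i • ξ (Fin.castSucc i) + p.1 • ξ (Fin.last n)) with hH
  have hHc : Continuous H := by fun_prop
  obtain ⟨K, hK⟩ := hφc.exists_bound_of_continuous hφ
  have hint : Integrable H (unitIntervalMeasure.prod (cubeMeasure (Fin n))) :=
    Integrable.of_bound hHc.aestronglyMeasurable K (Filter.Eventually.of_forall fun _ => hK _)
  have hmp := measurePreserving_piFinSuccAbove (fun _ : Fin (n + 1) => unitIntervalMeasure)
    (Fin.last n)
  have h1 := hmp.integral_comp (MeasurableEquiv.measurableEmbedding _) H
  simp only [cubeAverage]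
  refine Eq.trans ?_ (h1.trans (integral_prod _ hint))
  refine integral_congr_ae (Filter.Eventually.of_forall fun t => ?_)
  simp only [hH, Fin.sum_univ_castSucc]
  simp [MeasurableEquiv.piFinSuccAbove, Fin.insertNthEquiv, Fin.init]

theorem integral_boxSplineAux_zero_mul {Ξ : Matrix (Fin d) (Fin (d + 0)) ℝ}
    (h : (firstColumns Ξ).det ≠ 0) {φ : (Fin d → ℝ) → ℝ} (hφ : Continuous φ) :
    ∫ x, boxSplineAux d 0 Ξ x * φ x = cubeAverage (fun j i => Ξ i j) Finset.univ φ := by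
  set Z := firstColumns Ξ with hZ
  have hu : IsUnit Z.det := isUnit_iff_ne_zero.2 h
  set D : Set (Fin d → ℝ) := {y | ∀ i, (Z⁻¹.mulVec y) i ∈ Set.Ico (-(1:ℝ)/2) (1/2)} with hD
  have hDm : MeasurableSet D := by
    rw [hD, Set.ofPred_forall]
    refine MeasurableSet.iInter fun i => ?_
    have hc : Continuous fun y => (Z⁻¹.mulVec y) i := by
      unfold Matrix.mulVec dotProduct; fun_prop
    exact hc.measurable measurableSet_Ico
  have hZc : Continuous (Matrix.toLin' Z) := (Matrix.toLin' Z).continuous_of_finiteDimensional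
  have h1 : ∀ x, boxSplineAux d 0 Ξ x * φ x = |Z.det|⁻¹ * D.indicator φ x := by
    intro x
    rw [boxSplineAux_zero h, Set.indicator, Set.indicator]
    split_ifs <;> simp [hZ]
  have hmap := Real.map_matrix_volume_pi_eq_smul_volume_pi h
  have h2 : ∫ x, D.indicator φ x ∂(Measure.map (Matrix.toLin' Z) volume) =
      |Z.det|⁻¹ * ∫ x, D.indicator φ x := by
    rw [hmap, integral_smul_measure, ENNReal.toReal_ofReal (abs_nonneg _), abs_inv, smul_eq_mul]
  have h3 : Matrix.toLin' Z ⁻¹' D = Set.univ.pi fun _ : Fin d => Set.Ico (-(1:ℝ)/2) (1/2) := by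
    ext t
    simp only [hD, Set.mem_preimage, Matrix.toLin'_apply, Set.mem_ofPred_eq, Set.mem_univ_pi]
    rw [Matrix.mulVec_mulVec, Matrix.nonsing_inv_mul _ hu, Matrix.one_mulVec]
  simp only [h1]
  rw [integral_const_mul, ← h2, integral_map hZc.aemeasurable
    (hφ.measurable.indicator hDm).aestronglyMeasurable]
  have h4 : ∀ t, D.indicator φ (Matrix.toLin' Z t) =
      (Set.univ.pi fun _ : Fin d => Set.Ico (-(1:ℝ)/2) (1/2)).indicator
        (fun t => φ (Matrix.toLin' Z t)) t := fun t => by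
    rw [← h3]; rfl
  simp only [h4]
  rw [integral_indicator (MeasurableSet.univ_pi fun _ => measurableSet_Ico)]
  have h5 : (volume : Measure (Fin d → ℝ)).restrict
      (Set.univ.pi fun _ : Fin d => Set.Ico (-(1:ℝ)/2) (1/2)) = cubeMeasure (Fin d) := by
    rw [cubeMeasure_eq_restrict]
    exact Measure.restrict_congr_set
      (Measure.univ_pi_Ico_ae_eq_Icc.trans Measure.univ_pi_Ioc_ae_eq_Icc.symm)
  rw [h5]
  refine integral_congr_ae (Filter.Eventually.of_forall fun t => ?_)
  change φ (Matrix.toLin' Z t) = φ (∑ j : Fin d, t j • fun i => Ξ i j)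
  congr 1
  ext i
  simp only [Matrix.toLin'_apply, Matrix.mulVec, dotProduct, Finset.sum_apply, Pi.smul_apply,
    smul_eq_mul]
  exact Finset.sum_congr rfl fun j _ => mul_comm _ _

/-- The box spline is the density of the image of the unit cube measure. -/
theorem integral_boxSplineAux_mul {n : ℕ} {Ξ : Matrix (Fin d) (Fin (d + n)) ℝ}
    (h : (firstColumns Ξ).det ≠ 0) {φ : (Fin d → ℝ) → ℝ} (hφ : Continuous φ)
    (hφc : HasCompactSupport φ) :
    ∫ x, boxSplineAux d n Ξ x * φ x = cubeAverage (fun j i => Ξ i j) Finset.univ φ := by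
  induction n generalizing φ with
  | zero => exact integral_boxSplineAux_zero_mul h hφ
  | succ n ih =>
    set Ξ' : Matrix (Fin d) (Fin (d + n)) ℝ := fun i j => Ξ i (Fin.castSucc j) with hΞ'
    have h' : (firstColumns Ξ').det ≠ 0 := h
    set v : Fin d → ℝ := fun i => Ξ i (Fin.last (d + n)) with hv
    obtain ⟨B, hB⟩ := exists_abs_boxSplineAux_le h'
    have hm := measurable_boxSplineAux h'
    have hint : Integrable (fun p : (Fin d → ℝ) × ℝ => boxSplineAux d n Ξ' (p.1 - p.2 • v) * φ p.1)
        (volume.prod unitIntervalMeasure) :=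
      ((hφ.integrable_of_hasCompactSupport hφc).comp_fst _).bdd_mul
        (hm.comp (by fun_prop)).aestronglyMeasurable (Filter.Eventually.of_forall fun _ => hB _)
    calc ∫ x, boxSplineAux d (n + 1) Ξ x * φ x
        = ∫ x, (∫ t, boxSplineAux d n Ξ' (x - t • v) * φ x ∂unitIntervalMeasure) := by
          simp only [boxSplineAux_succ, ← integral_unitIntervalMeasure, integral_mul_const]
          rfl
      _ = ∫ t, (∫ x, boxSplineAux d n Ξ' (x - t • v) * φ x) ∂unitIntervalMeasure :=
          integral_integral_swap hint
      _ = ∫ t, (∫ x, boxSplineAux d n Ξ' x * φ (x + t • v)) ∂unitIntervalMeasure := by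
          congr 1
          ext t
          rw [← integral_add_right_eq_self _ (t • v)]
          simp only [add_sub_cancel_right]
      _ = ∫ t, cubeAverage (fun j i => Ξ' i j) Finset.univ (fun y => φ (y + t • v))
            ∂unitIntervalMeasure := by
          congr 1
          ext t
          exact ih h' (by fun_prop) (hφc.comp_add_right _)
      _ = cubeAverage (fun j i => Ξ i j) Finset.univ φ :=
          (cubeAverage_succ (n := d + n) (fun j i => Ξ i j) hφ hφc).symm

end BoxSpline

section ShiftSums

variable {d n : ℕ}

theorem exists_finite_forall_boxSplineAux_sub_eq_zero (Ξ : Matrix (Fin d) (Fin (d + n)) ℝ)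
    (r : ℝ) : ∃ F : Set (Fin d → ℤ), F.Finite ∧
      ∀ x, ‖x‖ ≤ r → ∀ j, j ∉ F → boxSplineAux d n Ξ (x - intCastVec d j) = 0 := by
  obtain ⟨R, hR⟩ := exists_norm_le_of_boxSplineAux_ne_zero Ξ
  refine ⟨_, finite_setOf_norm_intCastVec_le d (R + r), fun x hx j hj => ?_⟩
  by_contra hne
  refine hj ?_
  have h1 := hR _ hne
  have h2 := norm_sub_norm_le (intCastVec d j) x
  rw [norm_sub_rev] at h2
  simp only [Set.mem_ofPred_eq]
  linarith

theorem finite_support_mul_boxSplineAux_sub (Ξ : Matrix (Fin d) (Fin (d + n)) ℝ)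
    (c : (Fin d → ℤ) → ℝ) (x : Fin d → ℝ) :
    (Function.support fun j => c j * boxSplineAux d n Ξ (x - intCastVec d j)).Finite := by
  obtain ⟨F, hF, h⟩ := exists_finite_forall_boxSplineAux_sub_eq_zero Ξ ‖x‖
  refine hF.subset fun j hj => ?_
  by_contra hjF
  exact right_ne_zero_of_mul hj (h x le_rfl j hjF)

/-- The linear combination of the lattice shifts of a box spline with coefficients `c`. -/
noncomputable def shiftSum (Ξ : Matrix (Fin d) (Fin (d + n)) ℝ) (c : (Fin d → ℤ) → ℝ)
    (x : Fin d → ℝ) : ℝ :=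
  ∑ᶠ j, c j * boxSplineAux d n Ξ (x - intCastVec d j)

theorem exists_finset_forall_shiftSum_eq (Ξ : Matrix (Fin d) (Fin (d + n)) ℝ)
    (c : (Fin d → ℤ) → ℝ) (r : ℝ) : ∃ F : Finset (Fin d → ℤ), ∀ x, ‖x‖ ≤ r →
      shiftSum Ξ c x = ∑ j ∈ F, c j * boxSplineAux d n Ξ (x - intCastVec d j) := by
  obtain ⟨F, hF, h⟩ := exists_finite_forall_boxSplineAux_sub_eq_zero Ξ r
  refine ⟨hF.toFinset, fun x hx => finsum_eq_sum_of_support_subset _ fun j hj => ?_⟩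
  by_contra hjF
  exact right_ne_zero_of_mul hj (h x hx j (by simpa using hjF))

theorem integral_mul_shiftSum {Ξ : Matrix (Fin d) (Fin (d + n)) ℝ}
    (h : (firstColumns Ξ).det ≠ 0) (c : (Fin d → ℤ) → ℝ) {φ : (Fin d → ℝ) → ℝ}
    (hφ : Continuous φ) (hφc : HasCompactSupport φ) :
    ∫ x, φ x * shiftSum Ξ c x =
      ∑ᶠ j, c j * cubeAverage (fun k i => Ξ i k) Finset.univ
        (fun y => φ (y + intCastVec d j)) := by
  obtain ⟨R, hR⟩ := hφc.exists_norm_le_of_ne_zero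
  obtain ⟨F, hF, hF0⟩ := exists_finite_forall_boxSplineAux_sub_eq_zero Ξ R
  obtain ⟨B, hB⟩ := exists_abs_boxSplineAux_le h
  have hm := measurable_boxSplineAux h
  have hint : ∀ j, Integrable fun x => φ x * (c j * boxSplineAux d n Ξ (x - intCastVec d j)) := by
    intro j
    have h1 : Integrable fun x => boxSplineAux d n Ξ (x - intCastVec d j) * φ x :=
      (hφ.integrable_of_hasCompactSupport hφc).bdd_mul
        (hm.comp (by fun_prop)).aestronglyMeasurable (Filter.Eventually.of_forall fun _ => hB _)
    refine (h1.const_mul (c j)).congr (Filter.Eventually.of_forall fun x => ?_)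
    ring
  simp only [shiftSum, mul_finsum]
  rw [integral_finsum_of_ae_eq_zero hint hF]
  · congr 1
    ext j
    have h2 : ∀ x, φ x * (c j * boxSplineAux d n Ξ (x - intCastVec d j)) =
        c j * (boxSplineAux d n Ξ (x - intCastVec d j) * φ x) := fun x => by ring
    simp only [h2]
    rw [integral_const_mul, ← integral_boxSplineAux_mul h (by fun_prop) (hφc.comp_add_right _),
      ← integral_add_right_eq_self _ (intCastVec d j)]
    simp only [add_sub_cancel_right]
  · refine fun j hj => Filter.Eventually.of_forall fun x => ?_
    by_cases hx : φ x = 0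
    · simp [hx]
    · simp [hF0 x (hR x hx) j hj]

theorem locallyIntegrable_shiftSum {Ξ : Matrix (Fin d) (Fin (d + n)) ℝ}
    (h : (firstColumns Ξ).det ≠ 0) (c : (Fin d → ℤ) → ℝ) :
    LocallyIntegrable (shiftSum Ξ c) := by
  intro x
  refine ⟨Metric.ball x 1, Metric.ball_mem_nhds x one_pos, ?_⟩
  obtain ⟨F, hF⟩ := exists_finset_forall_shiftSum_eq Ξ c (‖x‖ + 1)
  obtain ⟨B, hB⟩ := exists_abs_boxSplineAux_le h
  have hm := measurable_boxSplineAux h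
  have hfin : IsFiniteMeasure ((volume : Measure (Fin d → ℝ)).restrict (Metric.ball x 1)) :=
    ⟨by simp⟩
  have hsum : IntegrableOn
      (fun y => ∑ j ∈ F, c j * boxSplineAux d n Ξ (y - intCastVec d j)) (Metric.ball x 1) :=
    integrable_finsetSum _ fun j _ => Integrable.const_mul
      (Integrable.of_bound (hm.comp (by fun_prop)).aestronglyMeasurable B
        (Filter.Eventually.of_forall fun _ => hB _)) _
  refine hsum.congr_fun (fun y hy => (hF y ?_).symm) measurableSet_ball
  have h1 := norm_sub_norm_le y x
  rw [mem_ball_iff_norm] at hy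
  linarith

theorem shiftSum_eq_zero_of_ae_eq_zero {Ξ : Matrix (Fin d) (Fin (d + n)) ℝ}
    (h : (firstColumns Ξ).det ≠ 0) {c : (Fin d → ℤ) → ℝ}
    (hae : ∀ᵐ x, shiftSum Ξ c x = 0) (x : Fin d → ℝ) : shiftSum Ξ c x = 0 := by
  obtain ⟨C, hC, h0, hlim⟩ := exists_tendsto_boxSplineAux h
  obtain ⟨F, hF⟩ := exists_finset_forall_shiftSum_eq Ξ c (‖x‖ + 1)
  have htend : Filter.Tendsto (fun y => shiftSum Ξ c (x + y)) (nhdsWithin 0 C)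
      (nhds (shiftSum Ξ c x)) := by
    rw [hF x (by linarith)]
    refine Filter.Tendsto.congr' (f₁ := fun y =>
      ∑ j ∈ F, c j * boxSplineAux d n Ξ (x - intCastVec d j + y)) ?_ ?_
    · filter_upwards [nhdsWithin_le_nhds (Metric.ball_mem_nhds (0 : Fin d → ℝ) one_pos)] with y hy
      rw [mem_ball_zero_iff] at hy
      rw [hF (x + y) ((norm_add_le x y).trans (by linarith))]
      simp only [sub_add_eq_add_sub]
    · exact tendsto_finsetSum _ fun j _ => (hlim _).const_mul _
  have hdense : Dense {y | shiftSum Ξ c (x + y) = 0} := by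
    refine Measure.dense_of_ae (μ := volume) ?_
    exact (measurePreserving_add_left volume x).quasiMeasurePreserving.ae hae
  have hne : (nhdsWithin 0 (C ∩ {y | shiftSum Ξ c (x + y) = 0})).NeBot :=
    mem_closure_iff_nhdsWithin_neBot.1
      (closure_minimal (hdense.open_subset_closure_inter hC) isClosed_closure h0)
  have htend' : Filter.Tendsto (fun y => shiftSum Ξ c (x + y))
      (nhdsWithin 0 (C ∩ {y | shiftSum Ξ c (x + y) = 0})) (nhds (shiftSum Ξ c x)) :=
    htend.mono_left (nhdsWithin_mono 0 Set.inter_subset_left)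
  refine tendsto_nhds_unique htend' (tendsto_const_nhds.congr' ?_)
  filter_upwards [self_mem_nhdsWithin] with y hy using hy.2.symm

/-- A linear combination of shifts vanishes everywhere if and only if it does so weakly. -/
theorem forall_shiftSum_eq_zero_iff {Ξ : Matrix (Fin d) (Fin (d + n)) ℤ}
    (h : (firstColumns (Ξ.map (Int.cast : ℤ → ℝ))).det ≠ 0) (c : (Fin d → ℤ) → ℝ) :
    (∀ x, shiftSum (Ξ.map (Int.cast : ℤ → ℝ)) c x = 0) ↔
      WeaklyVanishing (fun k i => Ξ i k) Finset.univ c := by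
  constructor
  · intro h0 φ hφ hφc
    refine (integral_mul_shiftSum h c hφ.continuous hφc).symm.trans ?_
    simp [h0]
  · intro hw
    refine shiftSum_eq_zero_of_ae_eq_zero h ?_
    refine ae_eq_zero_of_integral_contDiff_smul_eq_zero (locallyIntegrable_shiftSum h c)
      fun φ hφ hφc => ?_
    exact (integral_mul_shiftSum h c hφ.continuous hφc).trans (hw φ hφ hφc)

end ShiftSums

section Periodization

variable {ι : Type*} [Fintype ι] {d : ℕ}

theorem continuous_finsum_mul_comp_add (χ : (Fin d → ℤ) → ℝ) {φ : (Fin d → ℝ) → ℝ}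
    (hφ : Continuous φ) (hφc : HasCompactSupport φ) :
    Continuous fun y => ∑ᶠ j, χ j * φ (y + intCastVec d j) := by
  refine continuous_finsum (fun j => by fun_prop) fun x => ?_
  obtain ⟨R, hR⟩ := hφc.exists_norm_le_of_ne_zero
  refine ⟨Metric.ball x 1, Metric.ball_mem_nhds x one_pos,
    (finite_setOf_norm_intCastVec_le d (R + (‖x‖ + 1))).subset ?_⟩
  rintro j ⟨y, hy, hyx⟩
  have h1 := hR _ (right_ne_zero_of_mul hy)
  have h2 := norm_sub_norm_le y x
  rw [mem_ball_iff_norm] at hyx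
  have h3 := norm_sub_le (y + intCastVec d j) y
  rw [add_sub_cancel_left] at h3
  simp only [Set.mem_ofPred_eq]
  linarith

theorem cubeAverage_finsum (ξ : ι → Fin d → ℝ) (S : Finset ι) (χ : (Fin d → ℤ) → ℝ)
    {φ : (Fin d → ℝ) → ℝ} (hφ : Continuous φ) (hφc : HasCompactSupport φ) :
    cubeAverage ξ S (fun y => ∑ᶠ j, χ j * φ (y + intCastVec d j)) =
      ∑ᶠ j, χ j * cubeAverage ξ S (fun y => φ (y + intCastVec d j)) := by
  obtain ⟨F, hF, h⟩ := exists_finite_forall_notMem_ae_eq_zero ξ S hφc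
  rw [cubeAverage, integral_finsum_of_ae_eq_zero
    (fun j => Continuous.integrable_cubeMeasure (by fun_prop)) hF]
  · simp only [integral_const_mul, cubeAverage]
  · intro j hj
    filter_upwards [h j hj] with t ht
    simp only [Pi.zero_apply] at ht ⊢
    rw [ht, mul_zero]

theorem cubeAverage_add_sum_smul [DecidableEq ι] (ξ : ι → Fin d → ℝ) {Φ : (Fin d → ℝ) → ℝ}
    (hΦ : Continuous Φ) {κ : Type*} (f : κ → ι) (hper : ∀ k y, Φ (y + ξ (f k)) = Φ y)
    (r : κ → ℝ) (s : Finset κ) :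
    cubeAverage ξ Finset.univ (fun y => Φ (y + ∑ k ∈ s, r k • ξ (f k))) =
      cubeAverage ξ Finset.univ Φ := by
  classical
  induction s using Finset.induction_on with
  | empty => simp
  | insert k s hk ih =>
    rw [← ih]
    have hadd := cubeAverage_add_smul ξ (Finset.mem_univ (f k))
      (Φ := fun y => Φ (y + ∑ k ∈ s, r k • ξ (f k))) (by fun_prop)
      (fun y => by simp only [add_right_comm y (ξ (f k)), hper]) (r k)
    simpa only [Finset.sum_insert hk, add_assoc] using hadd

/-- A nonsingular square submatrix of determinant different from `±1` gives rise to a nonzero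
weakly vanishing combination of shifts. -/
theorem exists_weaklyVanishing_ne_zero [DecidableEq ι] {ξ : ι → Fin d → ℤ} {f : Fin d → ι}
    (hdet : (Matrix.of fun i k => ξ (f k) i).det ≠ 0)
    (hdet1 : |(Matrix.of fun i k => ξ (f k) i).det| ≠ 1) :
    ∃ c : (Fin d → ℤ) → ℝ, WeaklyVanishing ξ Finset.univ c ∧ c 0 ≠ 0 := by
  classical
  set Z := Matrix.of fun i k => ξ (f k) i with hZ
  set η : ι → Fin d → ℝ := fun i => intCastVec d (ξ i) with hη
  obtain ⟨γ, hγ⟩ : ∃ γ, γ ∉ Set.range Z.mulVec := by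
    by_contra! hcon
    have : Function.Surjective Z.mulVec := hcon
    rw [Matrix.mulVec_surjective_iff_isUnit, Matrix.isUnit_iff_isUnit_det,
      Int.isUnit_iff_abs_eq] at this
    exact hdet1 this
  let L : AddSubgroup (Fin d → ℤ) := Z.mulVecLin.toAddMonoidHom.range
  have hγL : γ ∉ L := fun ⟨v, hv⟩ => hγ ⟨v, hv⟩
  have hfL : ∀ k, ξ (f k) ∈ L := fun k => ⟨Pi.single k 1, by
    ext i
    simp [hZ]⟩
  set χ : (Fin d → ℤ) → ℝ := fun j => if j ∈ L then 1 else 0 with hχ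
  refine ⟨fun j => χ j - χ (j - γ), fun φ hφ hφc => ?_, ?_⟩
  · set Φ : (Fin d → ℝ) → ℝ := fun y => ∑ᶠ j, χ j * φ (y + intCastVec d j) with hΦ
    have hΦc : Continuous Φ := continuous_finsum_mul_comp_add χ hφ.continuous hφc
    have hper : ∀ k y, Φ (y + η (f k)) = Φ y := by
      intro k y
      simp only [hΦ]
      rw [← finsum_comp_equiv (Equiv.addRight (ξ (f k)))
        (f := fun j => χ j * φ (y + intCastVec d j))]
      congr 1
      ext j
      simp only [Equiv.coe_addRight, map_add, hχ, L.add_mem_cancel_right (hfL k)]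
      congr 2
      simp only [hη]
      abel
    have hZR : (Matrix.of fun i k => η (f k) i).det ≠ 0 := by
      rw [det_intCastVec_eq ξ f]
      exact_mod_cast hdet
    set W := (Matrix.of fun i k => η (f k) i) with hW
    have hγsum : intCastVec d γ = ∑ k, (W⁻¹.mulVec (intCastVec d γ)) k • η (f k) := by
      have h1 : W.mulVec (W⁻¹.mulVec (intCastVec d γ)) = intCastVec d γ := by
        rw [Matrix.mulVec_mulVec, Matrix.mul_nonsing_inv _ (isUnit_iff_ne_zero.2 hZR),
          Matrix.one_mulVec]
      conv_lhs => rw [← h1]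
      ext i
      simp only [hW, Matrix.mulVec, dotProduct, Matrix.of_apply, Finset.sum_apply, Pi.smul_apply,
        smul_eq_mul, mul_comm]
    set a : (Fin d → ℤ) → ℝ := fun j =>
      cubeAverage η Finset.univ fun y => φ (y + intCastVec d j) with ha
    have hfin : (Function.support a).Finite := finite_support_cubeAverage_add η _ hφc
    have f1 : ∀ b : (Fin d → ℤ) → ℝ, (Function.support fun j => b j * a j).Finite := fun b =>
      hfin.subset fun j hj => right_ne_zero_of_mul hj
    have e1 : ∑ᶠ j, χ j * a j = cubeAverage η Finset.univ Φ :=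
      (cubeAverage_finsum η _ χ hφ.continuous hφc).symm
    have e2 : ∑ᶠ j, χ (j - γ) * a j =
        cubeAverage η Finset.univ fun y => Φ (y + intCastVec d γ) := by
      have h2 := cubeAverage_finsum η Finset.univ χ
        (φ := fun y => φ (y + intCastVec d γ)) (hφ.continuous.comp (by fun_prop))
        (hφc.comp_add_right _)
      rw [← finsum_comp_equiv (Equiv.addRight γ)]
      simp only [Equiv.coe_addRight, add_sub_cancel_right, ha, map_add]
      simpa only [hΦ, add_assoc, add_comm, add_left_comm] using h2.symm
    calc ∑ᶠ j, (χ j - χ (j - γ)) * a j = ∑ᶠ j, (χ j * a j - χ (j - γ) * a j) := by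
          simp only [sub_mul]
      _ = 0 := by
          rw [finsum_sub_distrib (f1 _) (f1 _), e1, e2, hγsum,
            cubeAverage_add_sum_smul η hΦc f hper, sub_self]
  · have : -γ ∉ L := fun h => hγL (neg_mem_iff.1 h)
    simp [hχ, this, zero_mem]

end Periodization

theorem boxSplineAux_shifts_linearIndependent_iff {d n : ℕ} (Ξ : Matrix (Fin d) (Fin (d + n)) ℤ)
    (hΞ : LinearIndependent ℝ fun j : Fin d => fun i =>
      (Ξ.map (Int.cast : ℤ → ℝ)) i (Fin.castAdd n j)) :
    (∀ c : (Fin d → ℤ) → ℝ,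
        (∀ x : Fin d → ℝ,
          (Function.support fun j : Fin d → ℤ =>
            c j * boxSplineAux d n (Ξ.map (Int.cast : ℤ → ℝ)) (x - intCastVec d j)).Finite ∧
          ∑ᶠ j : Fin d → ℤ,
            c j * boxSplineAux d n (Ξ.map (Int.cast : ℤ → ℝ)) (x - intCastVec d j) = 0) →
        ∀ j : Fin d → ℤ, c j = 0) ↔
      (∀ f : Fin d → Fin (d + n), Function.Injective f →
        (Matrix.of fun i k => Ξ i (f k)).det ≠ 0 →
        |(Matrix.of fun i k => Ξ i (f k)).det| = 1) := by
  have hdet : (firstColumns (Ξ.map (Int.cast : ℤ → ℝ))).det ≠ 0 := by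
    have hu := (Matrix.linearIndependent_cols_iff_isUnit
      (A := firstColumns (Ξ.map (Int.cast : ℤ → ℝ)))).1 hΞ
    rwa [Matrix.isUnit_iff_isUnit_det, isUnit_iff_ne_zero] at hu
  constructor
  · intro H f _ hf
    by_contra h1
    obtain ⟨c, hc, hc0⟩ := exists_weaklyVanishing_ne_zero (ξ := fun k i => Ξ i k) (f := f) hf h1
    exact hc0 (H c (fun x => ⟨finite_support_mul_boxSplineAux_sub _ c x,
      (forall_shiftSum_eq_zero_iff hdet c).2 hc x⟩) 0)
  · intro hU c hc
    refine WeaklyVanishing.eq_zero (ξ := fun k i => Ξ i k) hU Finset.univ ?_ c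
      ((forall_shiftSum_eq_zero_iff hdet c).1 fun x => (hc x).2)
    rw [Finset.coe_univ, Set.image_univ, ← top_le_iff,
      ← hΞ.span_eq_top_of_card_eq_finrank' (by simp)]
    refine Submodule.span_mono ?_
    rintro _ ⟨j, rfl⟩
    exact ⟨Fin.castAdd n j, rfl⟩

/-- for an integer direction matrix, the `ℤ^d`-shifts of the centered box
spline are linearly independent if and only if every invertible `d×d` submatrix of `Ξ`
(obtained by selecting `d` columns) has determinant `±1`. -/
theorem boxSpline_shifts_linearIndependent_iff_unimodular {d m : ℕ} (hd : 1 ≤ d)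
    (hdm : d ≤ m) (Ξ : Matrix (Fin d) (Fin m) ℤ)
    (hΞ : LinearIndependent ℝ fun j : Fin d => fun i =>
      (Ξ.map (Int.cast : ℤ → ℝ)) i (Fin.castLE hdm j)) :
    (∀ c : (Fin d → ℤ) → ℝ,
        (∀ x : Fin d → ℝ,
          (Function.support fun j : Fin d → ℤ =>
            c j * boxSpline hdm (Ξ.map (Int.cast : ℤ → ℝ)) (x - fun i => (j i : ℝ))).Finite ∧
          ∑ᶠ j : Fin d → ℤ,
            c j * boxSpline hdm (Ξ.map (Int.cast : ℤ → ℝ)) (x - fun i => (j i : ℝ)) = 0) →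
        ∀ j : Fin d → ℤ, c j = 0) ↔
      (∀ f : Fin d → Fin m, Function.Injective f →
        (Matrix.of fun i k => Ξ i (f k)).det ≠ 0 →
        |(Matrix.of fun i k => Ξ i (f k)).det| = 1) := by
  have key : ∀ (k : ℕ) (h : d + k = m),
      (∀ c : (Fin d → ℤ) → ℝ,
        (∀ x : Fin d → ℝ,
          (Function.support fun j : Fin d → ℤ =>
            c j * boxSplineAux d k (fun i l => (Ξ.map (Int.cast : ℤ → ℝ)) i (Fin.cast h l))
              (x - fun i => (j i : ℝ))).Finite ∧
          ∑ᶠ j : Fin d → ℤ,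
            c j * boxSplineAux d k (fun i l => (Ξ.map (Int.cast : ℤ → ℝ)) i (Fin.cast h l))
              (x - fun i => (j i : ℝ)) = 0) →
        ∀ j : Fin d → ℤ, c j = 0) ↔
      (∀ f : Fin d → Fin m, Function.Injective f →
        (Matrix.of fun i k => Ξ i (f k)).det ≠ 0 →
        |(Matrix.of fun i k => Ξ i (f k)).det| = 1) := by
    rintro k rfl
    exact boxSplineAux_shifts_linearIndependent_iff Ξ hΞ
  exact key (m - d) (Nat.add_sub_cancel' hdm)
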